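/- arXiv:1506.06745 — 4 statements merged into one kernel-verified Lean document; each statement's English description precedes it below -/
import Mathlib

section
/- Let u, v ∈ ℝ, let w, h > 0, let n ∈ ℕ, and for i, j ∈ ℤ let T_{ij}^n = [u + i·w/2^n, u + (i+1)·w/2^n) × [v + j·h/2^n, v + (j+1)·h/2^n) be the level-n tiles. Let P = [a₁, a₂] × [b₁, b₂] be a closed axis-aligned rectangle with a₂ − a₁ ≤ w/2^n and b₂ − b₁ ≤ h/2^n. Then P has nonempty intersection with at most four of the tiles T_{ij}^n. -/
/-- The level-`n` tile with indices `(i, j)`. -/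
def tile (u v w h : ℝ) (n : ℕ) (i j : ℤ) : Set (ℝ × ℝ) :=
  Set.Ico (u + i * (w / 2 ^ n)) (u + (i + 1) * (w / 2 ^ n)) ×ˢ
    Set.Ico (v + j * (h / 2 ^ n)) (v + (j + 1) * (h / 2 ^ n))

/-- A closed interval of length at most `d` meets only cells of the grid `c + d ℤ` whose index is
that of the cell containing the left endpoint, or the next one. -/
theorem mem_Icc_floor_of_Icc_inter_Ico_nonempty {c d a b : ℝ} (hd : 0 < d) (hab : b - a ≤ d)
    {i : ℤ} (hi : (Set.Icc a b ∩ Set.Ico (c + i * d) (c + (i + 1) * d)).Nonempty) :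
    i ∈ Finset.Icc ⌊(a - c) / d⌋ (⌊(a - c) / d⌋ + 1) := by
  obtain ⟨x, ⟨hax, hxb⟩, hix, hxi⟩ := hi
  rw [Finset.mem_Icc]
  constructor
  · rw [← Int.lt_add_one_iff, Int.floor_lt, div_lt_iff₀ hd]
    push_cast
    linarith
  · rw [← sub_le_iff_le_add, Int.le_floor, le_div_iff₀ hd]
    push_cast
    linarith

/-- A closed axis-aligned rectangle of width at most `w/2^n` and height at most `h/2^n`
meets at most four of the level-`n` tiles. -/
theorem rect_meets_at_most_four_tiles
    (u v w h : ℝ) (hw : 0 < w) (hh : 0 < h) (n : ℕ)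
    (a₁ a₂ b₁ b₂ : ℝ) (ha : a₁ ≤ a₂) (hb : b₁ ≤ b₂)
    (hwP : a₂ - a₁ ≤ w / 2 ^ n) (hhP : b₂ - b₁ ≤ h / 2 ^ n) :
    {p : ℤ × ℤ |
        ((Set.Icc a₁ a₂ ×ˢ Set.Icc b₁ b₂) ∩ tile u v w h n p.1 p.2).Nonempty}.ncard ≤ 4 := by
  have hsub : {p : ℤ × ℤ |
      ((Set.Icc a₁ a₂ ×ˢ Set.Icc b₁ b₂) ∩ tile u v w h n p.1 p.2).Nonempty} ⊆
      ↑(Finset.Icc ⌊(a₁ - u) / (w / 2 ^ n)⌋ (⌊(a₁ - u) / (w / 2 ^ n)⌋ + 1) ×ˢ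
        Finset.Icc ⌊(b₁ - v) / (h / 2 ^ n)⌋ (⌊(b₁ - v) / (h / 2 ^ n)⌋ + 1)) := by
    rintro ⟨i, j⟩ hij
    rw [Set.mem_ofPred_eq, tile, Set.prod_inter_prod, Set.prod_nonempty_iff] at hij
    exact Finset.mem_product.2
      ⟨mem_Icc_floor_of_Icc_inter_Ico_nonempty (by positivity) hwP hij.1,
        mem_Icc_floor_of_Icc_inter_Ico_nonempty (by positivity) hhP hij.2⟩
  refine (Set.ncard_le_ncard hsub (Finset.finite_toSet _)).trans ?_
  rw [Set.ncard_coe_finset, Finset.card_product, Int.card_Icc, Int.card_Icc, add_assoc, add_assoc,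
    add_sub_cancel_left, add_sub_cancel_left]
  decide
end

section
/- Let u, v ∈ ℝ, let w, h > 0, let n ∈ ℕ, let B = [u, u+w) × [v, v+h), and let T_{ij}^n = [u + i·w/2^n, u + (i+1)·w/2^n) × [v + j·h/2^n, v + (j+1)·h/2^n) for i, j ∈ ℤ be the level-n tiles. Let F be a finite family of nonempty subsets of B, and let q ∈ ℕ be such that every tile T_{ij}^n intersects at most q members of F. Let P = [a₁, a₂] × [b₁, b₂] be a closed axis-aligned rectangle with a₂ − a₁ ≤ w/2^n and b₂ − b₁ ≤ h/2^n. Then the number of members of F that have nonempty intersection with P is at most 4q. -/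
/-- An interval of length at most `d > 0` is covered by two consecutive cells of the grid
`u + ℤ d`. -/
lemma exists_Icc_subset_grid_cells {u d a b : ℝ} (hd : 0 < d) (hab : b - a ≤ d) :
    ∃ i : ℤ, ∀ x ∈ Set.Icc a b, ∃ k ∈ ({i, i + 1} : Finset ℤ),
      x ∈ Set.Ico (u + k * d) (u + (k + 1) * d) := by
  refine ⟨⌊(a - u) / d⌋, fun x hx => ?_⟩
  set i := ⌊(a - u) / d⌋
  have h1 : (i : ℝ) * d ≤ a - u := (le_div_iff₀ hd).1 (Int.floor_le _)
  have h2 : a - u < ((i : ℝ) + 1) * d := (div_lt_iff₀ hd).1 (Int.lt_floor_add_one _)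
  obtain ⟨hax, hxb⟩ := hx
  rcases lt_or_ge x (u + ((i : ℝ) + 1) * d) with hlt | hge
  · exact ⟨i, by simp, by linarith, hlt⟩
  · refine ⟨i + 1, by simp, ?_, ?_⟩ <;> push_cast <;> linarith

/-- If every level-`n` tile meets at most `q` members of a finite family `F` of nonempty
subsets of `B = [u, u+w) × [v, v+h)`, then a closed rectangle no larger than a tile meets
at most `4q` members of `F`. -/
theorem rect_meets_at_most_4q_members
    (u v w h : ℝ) (hw : 0 < w) (hh : 0 < h) (n : ℕ)
    (F : Set (Set (ℝ × ℝ))) (hFfin : F.Finite)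
    (hFsub : ∀ s ∈ F, s.Nonempty ∧ s ⊆ Set.Ico u (u + w) ×ˢ Set.Ico v (v + h))
    (q : ℕ)
    (hquota : ∀ i j : ℤ, {s | s ∈ F ∧ (s ∩ tile u v w h n i j).Nonempty}.ncard ≤ q)
    (a₁ a₂ b₁ b₂ : ℝ) (ha : a₁ ≤ a₂) (hb : b₁ ≤ b₂)
    (hwP : a₂ - a₁ ≤ w / 2 ^ n) (hhP : b₂ - b₁ ≤ h / 2 ^ n) :
    {s | s ∈ F ∧ (s ∩ (Set.Icc a₁ a₂ ×ˢ Set.Icc b₁ b₂)).Nonempty}.ncard ≤ 4 * q := by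
  obtain ⟨i, hi⟩ := exists_Icc_subset_grid_cells (u := u) (by positivity) hwP
  obtain ⟨j, hj⟩ := exists_Icc_subset_grid_cells (u := v) (by positivity) hhP
  set I : Finset (ℤ × ℤ) := {i, i + 1} ×ˢ {j, j + 1}
  let M : ℤ × ℤ → Set (Set (ℝ × ℝ)) :=
    fun p => {s | s ∈ F ∧ (s ∩ tile u v w h n p.1 p.2).Nonempty}
  have hcover : {s | s ∈ F ∧ (s ∩ (Set.Icc a₁ a₂ ×ˢ Set.Icc b₁ b₂)).Nonempty} ⊆
      ⋃ p ∈ I, M p := by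
    rintro s ⟨hsF, x, hxs, hx₁, hx₂⟩
    obtain ⟨k, hk, hxk⟩ := hi _ hx₁
    obtain ⟨l, hl, hxl⟩ := hj _ hx₂
    exact Set.mem_biUnion (x := (k, l)) (Finset.mem_product.2 ⟨hk, hl⟩)
      ⟨hsF, x, hxs, hxk, hxl⟩
  have hfin : (⋃ p ∈ I, M p).Finite :=
    hFfin.subset (Set.iUnion₂_subset fun _ _ _ hs => hs.1)
  calc _ ≤ (⋃ p ∈ I, M p).ncard := Set.ncard_le_ncard hcover hfin
    _ ≤ ∑ p ∈ I, (M p).ncard := Finset.set_ncard_biUnion_le I M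
    _ ≤ I.card * q := by
      simpa using Finset.sum_le_card_nsmul I _ q fun p _ => hquota p.1 p.2
    _ = 4 * q := by simp [I]
end

section
/- Let u, v ∈ ℝ, let w, h > 0, let B = [u, u+w) × [v, v+h), and for each n ∈ ℕ and i, j ∈ ℤ let T_{ij}^n = [u + i·w/2^n, u + (i+1)·w/2^n) × [v + j·h/2^n, v + (j+1)·h/2^n). Let Q ∈ ℕ. Let P = [a₁, a₂] × [b₁, b₂] be a closed axis-aligned rectangle with a₁ < a₂ and b₁ < b₂, let Z = min(w/(a₂−a₁), h/(b₂−b₁)), and let n = max(0, ⌊log₂ Z⌋) ∈ ℕ. Let F be a finite family of nonempty subsets of B such that every level-n tile T_{ij}^n intersects at most Q/4 members of F (Q divisible by 4). Then the number of members of F that have nonempty intersection with P is at most Q. -/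
/-- An interval of length at most `c` meets at most two consecutive cells of a grid of
mesh `c`. -/
theorem exists_two_consecutive_cells_cover {u c a b : ℝ} (hc : 0 < c) (hab : b - a ≤ c) :
    ∃ i : ℤ, ∀ x ∈ Set.Icc a b,
      x ∈ Set.Ico (u + i * c) (u + (i + 1) * c) ∨
        x ∈ Set.Ico (u + (i + 1 : ℤ) * c) (u + ((i + 1 : ℤ) + 1) * c) := by
  refine ⟨⌊(a - u) / c⌋, fun x hx => ?_⟩
  have hlo := (le_div_iff₀ hc).1 (Int.floor_le ((a - u) / c))
  have hhi := (div_lt_iff₀ hc).1 (Int.lt_floor_add_one ((a - u) / c))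
  obtain ⟨hax, hxb⟩ := hx
  push_cast
  rcases lt_or_ge x (u + (⌊(a - u) / c⌋ + 1) * c) with hlt | hge
  · exact Or.inl ⟨by linarith, hlt⟩
  · exact Or.inr ⟨hge, by linarith⟩

/-- The part of `[a, b]` inside `[u, u + w)` meets at most two consecutive dyadic cells of
level `n`, if `n = 0` or the relative zoom `w / (b - a)` is at least `2 ^ n`. -/
theorem exists_two_consecutive_dyadic_cells_cover {u w a b : ℝ} {n : ℕ} (hw : 0 < w)
    (hab : a < b) (hn : n = 0 ∨ (2 : ℝ) ^ n ≤ w / (b - a)) :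
    ∃ i : ℤ, ∀ x ∈ Set.Ico u (u + w), x ∈ Set.Icc a b →
      x ∈ Set.Ico (u + i * (w / 2 ^ n)) (u + (i + 1) * (w / 2 ^ n)) ∨
        x ∈ Set.Ico (u + (i + 1 : ℤ) * (w / 2 ^ n))
          (u + ((i + 1 : ℤ) + 1) * (w / 2 ^ n)) := by
  rcases hn with rfl | hn
  · exact ⟨0, fun x hx _ => Or.inl (by simpa using hx)⟩
  · have hlen : b - a ≤ w / 2 ^ n :=
      (le_div_comm₀ (by positivity) (sub_pos.2 hab)).1 hn
    obtain ⟨i, hi⟩ := exists_two_consecutive_cells_cover (u := u)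
      (show 0 < w / 2 ^ n by positivity) hlen
    exact ⟨i, fun x _ hx => hi x hx⟩

theorem eq_zero_or_two_pow_le_of_eq_max_floor_logb {Z : ℝ} {n : ℕ} (hZ : 0 < Z)
    (hn : (n : ℤ) = max 0 ⌊Real.logb 2 Z⌋) : n = 0 ∨ (2 : ℝ) ^ n ≤ Z := by
  rcases max_choice 0 ⌊Real.logb 2 Z⌋ with h | h <;> rw [h] at hn
  · exact Or.inl (by exact_mod_cast hn)
  · right
    have hle : ((n : ℤ) : ℝ) ≤ Real.logb 2 Z := Int.le_floor.1 hn.le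
    rw [Int.cast_natCast, Real.le_logb_iff_rpow_le one_lt_two hZ, Real.rpow_natCast] at hle
    exact hle

/-- Node-count part of GraphMaps' Theorem 1: if each level-`n` tile (where
`n = max(0, ⌊log₂ Z⌋)` and `Z` is the zoom level of the viewport `P`) meets at most `Q/4`
members of the finite family `F` of nonempty subsets of `B`, then at most `Q` members of
`F` meet `P`. -/
theorem viewport_meets_at_most_Q_members
    (u v w h : ℝ) (hw : 0 < w) (hh : 0 < h)
    (Q : ℕ) (hQ : 4 ∣ Q)
    (a₁ a₂ b₁ b₂ : ℝ) (ha : a₁ < a₂) (hb : b₁ < b₂)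
    (Z : ℝ) (hZ : Z = min (w / (a₂ - a₁)) (h / (b₂ - b₁)))
    (n : ℕ) (hn : (n : ℤ) = max 0 ⌊Real.logb 2 Z⌋)
    (F : Set (Set (ℝ × ℝ))) (hFfin : F.Finite)
    (hFsub : ∀ s ∈ F, s.Nonempty ∧ s ⊆ Set.Ico u (u + w) ×ˢ Set.Ico v (v + h))
    (hquota : ∀ i j : ℤ, {s | s ∈ F ∧ (s ∩ tile u v w h n i j).Nonempty}.ncard ≤ Q / 4) :
    {s | s ∈ F ∧ (s ∩ (Set.Icc a₁ a₂ ×ˢ Set.Icc b₁ b₂)).Nonempty}.ncard ≤ Q := by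
  have hzoom : n = 0 ∨ (2 : ℝ) ^ n ≤ Z := by
    refine eq_zero_or_two_pow_le_of_eq_max_floor_logb ?_ hn
    rw [hZ]
    exact lt_min (div_pos hw (sub_pos.2 ha)) (div_pos hh (sub_pos.2 hb))
  rw [hZ, le_min_iff] at hzoom
  obtain ⟨i, hi⟩ := exists_two_consecutive_dyadic_cells_cover (u := u) hw ha
    (hzoom.imp_right And.left)
  obtain ⟨j, hj⟩ := exists_two_consecutive_dyadic_cells_cover (u := v) hh hb
    (hzoom.imp_right And.right)
  let M : ℤ → ℤ → Set (Set (ℝ × ℝ)) :=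
    fun k l => {s | s ∈ F ∧ (s ∩ tile u v w h n k l).Nonempty}
  have hM (k l : ℤ) : (M k l).ncard ≤ Q / 4 := hquota k l
  have hMfin (k l : ℤ) : (M k l).Finite := hFfin.subset fun _ hs => hs.1
  have hcover : {s | s ∈ F ∧ (s ∩ (Set.Icc a₁ a₂ ×ˢ Set.Icc b₁ b₂)).Nonempty} ⊆
      (M i j ∪ M i (j + 1)) ∪ (M (i + 1) j ∪ M (i + 1) (j + 1)) := by
    rintro s ⟨hs, p, hps, hpx, hpy⟩
    obtain ⟨hBx, hBy⟩ := (hFsub s hs).2 hps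
    rcases hi p.1 hBx hpx with hx | hx <;> rcases hj p.2 hBy hpy with hy | hy
    · exact Or.inl (Or.inl ⟨hs, p, hps, hx, hy⟩)
    · exact Or.inl (Or.inr ⟨hs, p, hps, hx, hy⟩)
    · exact Or.inr (Or.inl ⟨hs, p, hps, hx, hy⟩)
    · exact Or.inr (Or.inr ⟨hs, p, hps, hx, hy⟩)
  have hcard := Set.ncard_le_ncard hcover
    (((hMfin _ _).union (hMfin _ _)).union ((hMfin _ _).union (hMfin _ _)))
  have hunion := Set.ncard_union_le (M i j ∪ M i (j + 1)) (M (i + 1) j ∪ M (i + 1) (j + 1))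
  have hleft := Set.ncard_union_le (M i j) (M i (j + 1))
  have hright := Set.ncard_union_le (M (i + 1) j) (M (i + 1) (j + 1))
  have h₀₀ := hM i j
  have h₀₁ := hM i (j + 1)
  have h₁₀ := hM (i + 1) j
  have h₁₁ := hM (i + 1) (j + 1)
  omega
end

section
/- Let u, v ∈ ℝ, let w, h > 0, let B = [u, u+w) × [v, v+h), and for each n ∈ ℕ and i, j ∈ ℤ let T_{ij}^n = [u + i·w/2^n, u + (i+1)·w/2^n) × [v + j·h/2^n, v + (j+1)·h/2^n). Let Q ∈ ℕ be divisible by 4. Let R be a finite family of nonempty subsets of B, and let R^max ⊆ R be the set of members of R that are maximal with respect to set inclusion. Let P = [a₁, a₂] × [b₁, b₂] be a closed axis-aligned rectangle with a₁ < a₂ and b₁ < b₂, let Z = min(w/(a₂−a₁), h/(b₂−b₁)), and let n = max(0, ⌊log₂ Z⌋). Assume every level-n tile T_{ij}^n intersects at most Q/4 members of R^max. Then the set { m ∈ R^max : there exists r ∈ R with r ⊆ m and r ∩ P ≠ ∅ } has at most Q elements. -/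
/-- The members of `R` that are maximal in `R` with respect to set inclusion. -/
def maximalMembers (R : Set (Set (ℝ × ℝ))) : Set (Set (ℝ × ℝ)) :=
  {m | m ∈ R ∧ ∀ r ∈ R, m ⊆ r → m = r}

/-- A closed interval no longer than `s` meets at most two consecutive cells of the grid of
mesh `s` with origin `o`. -/
theorem exists_Icc_subset_Ico_union_Ico {o s a b : ℝ} (hs : 0 < s) (hab : b - a ≤ s) :
    ∃ i : ℤ, ∀ x ∈ Set.Icc a b,
      ∃ k ∈ ({i, i + 1} : Finset ℤ), x ∈ Set.Ico (o + k * s) (o + (k + 1) * s) := by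
  refine ⟨⌊(a - o) / s⌋, fun x hx => ?_⟩
  obtain ⟨hax, hxb⟩ := hx
  have h₁ := (le_div_iff₀ hs).1 (Int.floor_le ((a - o) / s))
  have h₂ := (div_lt_iff₀ hs).1 (Int.lt_floor_add_one ((a - o) / s))
  rcases lt_or_ge x (o + (⌊(a - o) / s⌋ + 1) * s) with hx | hx
  · exact ⟨_, by simp, by linarith, hx⟩
  · refine ⟨⌊(a - o) / s⌋ + 1, by simp, ?_, ?_⟩ <;> push_cast <;> linarith

/-- Rail-count part of GraphMaps' Theorem 1: if each level-`n` tile (where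
`n = max(0, ⌊log₂ Z⌋)` and `Z` is the zoom level of the viewport `P`) meets at most `Q/4`
maximal members of the finite rail family `R`, then the maximal rails covering the rails
rendered for `P` number at most `Q`. -/
theorem rendered_rails_covered_by_at_most_Q_maximal
    (u v w h : ℝ) (hw : 0 < w) (hh : 0 < h)
    (Q : ℕ) (hQ : 4 ∣ Q)
    (R : Set (Set (ℝ × ℝ))) (hRfin : R.Finite)
    (hRsub : ∀ r ∈ R, r.Nonempty ∧ r ⊆ Set.Ico u (u + w) ×ˢ Set.Ico v (v + h))
    (a₁ a₂ b₁ b₂ : ℝ) (ha : a₁ < a₂) (hb : b₁ < b₂)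
    (Z : ℝ) (hZ : Z = min (w / (a₂ - a₁)) (h / (b₂ - b₁)))
    (n : ℕ) (hn : (n : ℤ) = max 0 ⌊Real.logb 2 Z⌋)
    (hquota : ∀ i j : ℤ,
      {m | m ∈ maximalMembers R ∧ (m ∩ tile u v w h n i j).Nonempty}.ncard ≤ Q / 4) :
    {m | m ∈ maximalMembers R ∧
        ∃ r ∈ R, r ⊆ m ∧ (r ∩ (Set.Icc a₁ a₂ ×ˢ Set.Icc b₁ b₂)).Nonempty}.ncard ≤ Q := by
  have hmaxfin : (maximalMembers R).Finite := hRfin.subset fun m hm => hm.1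
  have hdiv : Q / 4 * 4 = Q := Nat.div_mul_cancel hQ
  rcases Nat.eq_zero_or_pos n with rfl | hpos
  · refine (Set.ncard_le_ncard ?_ (hmaxfin.subset fun m hm => hm.1)).trans
      ((hquota 0 0).trans (Nat.div_le_self Q 4))
    rintro m ⟨hm, -⟩
    obtain ⟨⟨x, hx⟩, hmB⟩ := hRsub m hm.1
    exact ⟨hm, x, hx, by simpa [tile] using hmB hx⟩
  · have hfloor : (n : ℤ) ≤ ⌊Real.logb 2 Z⌋ := by omega
    have hda : 0 < a₂ - a₁ := sub_pos.2 ha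
    have hdb : 0 < b₂ - b₁ := sub_pos.2 hb
    have hZpos : 0 < Z := hZ ▸ lt_min (div_pos hw hda) (div_pos hh hdb)
    have hpow : (2 : ℝ) ^ n ≤ Z := by
      have hlog : (n : ℝ) ≤ Real.logb 2 Z := by exact_mod_cast Int.le_floor.1 hfloor
      simpa using (Real.le_logb_iff_rpow_le one_lt_two hZpos).1 hlog
    have h2 : (0 : ℝ) < 2 ^ n := by positivity
    have hwidth : a₂ - a₁ ≤ w / 2 ^ n := by
      have := (le_div_iff₀ hda).1 (hpow.trans (hZ ▸ min_le_left _ _))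
      exact (le_div_iff₀ h2).2 (by linarith)
    have hheight : b₂ - b₁ ≤ h / 2 ^ n := by
      have := (le_div_iff₀ hdb).1 (hpow.trans (hZ ▸ min_le_right _ _))
      exact (le_div_iff₀ h2).2 (by linarith)
    obtain ⟨i, hi⟩ := exists_Icc_subset_Ico_union_Ico (o := u) (div_pos hw h2) hwidth
    obtain ⟨j, hj⟩ := exists_Icc_subset_Ico_union_Ico (o := v) (div_pos hh h2) hheight
    let I : Finset (ℤ × ℤ) := {i, i + 1} ×ˢ {j, j + 1}
    let M : ℤ × ℤ → Set (Set (ℝ × ℝ)) := fun k =>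
      {m | m ∈ maximalMembers R ∧ (m ∩ tile u v w h n k.1 k.2).Nonempty}
    have hcard : I.card = 4 := by simp [I, Finset.card_product]
    have hfin : (⋃ k ∈ I, M k).Finite :=
      I.finite_toSet.biUnion fun k _ => hmaxfin.subset fun m hm => hm.1
    calc _ ≤ (⋃ k ∈ I, M k).ncard := by
          refine Set.ncard_le_ncard ?_ hfin
          rintro m ⟨hm, r, -, hrm, x, hxr, hx₁, hx₂⟩
          obtain ⟨k, hk, hxk⟩ := hi x.1 hx₁
          obtain ⟨l, hl, hxl⟩ := hj x.2 hx₂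
          exact Set.mem_biUnion (show (k, l) ∈ I from Finset.mem_product.2 ⟨hk, hl⟩)
            ⟨hm, x, hrm hxr, hxk, hxl⟩
      _ ≤ ∑ k ∈ I, (M k).ncard := Finset.set_ncard_biUnion_le I M
      _ ≤ I.card • (Q / 4) := Finset.sum_le_card_nsmul _ _ _ fun k _ => hquota k.1 k.2
      _ = Q := by rw [hcard, smul_eq_mul, mul_comm, hdiv]
end
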